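/- Let E be a real Hilbert space and f : E → ℝ a differentiable function that is bounded below and satisfies |⟨∇f(x + tη) − ∇f(x), η⟩| ≤ L t for some L > 0, for all x ∈ E, unit vectors η ∈ E, and t ≥ 0. Fix 0 < c₁ < c₂ < 1 and x_0 ∈ E, and generate sequences by: η_0 = −∇f(x_0); x_{k+1} = x_k + α_k η_k where α_k > 0 satisfies the weak Wolfe conditions f(x_k + α_k η_k) ≤ f(x_k) + c₁ α_k ⟨∇f(x_k), η_k⟩ and ⟨∇f(x_{k+1}), η_k⟩ ≥ c₂ ⟨∇f(x_k), η_k⟩; β_{k+1} = ‖∇f(x_{k+1})‖² / ⟨η_k, ∇f(x_{k+1}) − ∇f(x_k)⟩; η_{k+1} = −∇f(x_{k+1}) + β_{k+1} η_k. If ∇f(x_k) ≠ 0 for all k, then liminf_{k→∞} ‖∇f(x_k)‖ = 0. -/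

import Mathlib

open RealInnerProductSpace

/-- The reciprocals of a positive sequence of at most linear growth are not summable. -/
theorem not_summable_inv_of_le_add {r : ℕ → ℝ} {C : ℝ} {N : ℕ} (hr : ∀ k, 0 < r k)
    (hstep : ∀ k, N ≤ k → r (k + 1) ≤ r k + C) : ¬ Summable fun k => (r k)⁻¹ := by
  intro hsum
  set M := max (r N) C
  have hM : 0 < M := lt_max_of_lt_left (hr N)
  have hbound : ∀ n : ℕ, r (n + N) ≤ M * (n + 1) := by
    intro n
    induction n with
    | zero =>
      have h0 : r N ≤ M := le_max_left _ _
      simpa using h0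
    | succ n ih =>
      have h1 := hstep (n + N) (Nat.le_add_left N n)
      have h2 : C ≤ M := le_max_right _ _
      rw [Nat.add_right_comm n 1 N]
      push_cast
      linarith
  have hshift : Summable fun n : ℕ => M * (r (n + N))⁻¹ :=
    ((summable_nat_add_iff N).2 hsum).mul_left M
  have hharm : Summable fun n : ℕ => 1 / ((n + 1 : ℕ) : ℝ) := by
    refine hshift.of_nonneg_of_le (fun n => by positivity) fun n => ?_
    have h := hbound n
    have hn := hr (n + N)
    rw [← div_eq_mul_inv, div_le_div_iff₀ (by positivity) hn]
    push_cast
    linarith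
  exact Real.not_summable_one_div_natCast
    ((summable_nat_add_iff (f := fun n : ℕ => 1 / (n : ℝ)) 1).1 hharm)

/-- If each term of a sequence is dominated by the decrease of a sequence bounded below,
then the sequence is summable. -/
theorem summable_of_le_sub_succ {u F : ℕ → ℝ} {m : ℝ} (hu : ∀ k, 0 ≤ u k)
    (hF : ∀ k, m ≤ F k) (h : ∀ k, u k ≤ F k - F (k + 1)) : Summable u := by
  refine summable_of_sum_range_le (c := F 0 - m) hu fun n => ?_
  calc ∑ i ∈ Finset.range n, u i ≤ ∑ i ∈ Finset.range n, (F i - F (i + 1)) :=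
        Finset.sum_le_sum fun i _ => h i
    _ = F 0 - F n := Finset.sum_range_sub' F n
    _ ≤ F 0 - m := by linarith [hF n]

/-- The liminf of a nonnegative real sequence with no positive eventual lower bound is zero. -/
theorem liminf_eq_zero_of_no_eventual_pos_lower_bound {u : ℕ → ℝ} (hu : ∀ k, 0 ≤ u k)
    (h : ∀ a, 0 < a → ¬ ∀ᶠ k in Filter.atTop, a ≤ u k) :
    Filter.liminf u Filter.atTop = 0 := by
  rw [Filter.liminf_eq]
  refine IsGreatest.csSup_eq ⟨Filter.Eventually.of_forall hu, fun a ha => ?_⟩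
  by_contra! hpos
  exact h a hpos ha

section DaiYuan

variable {E : Type*} [NormedAddCommGroup E] [InnerProductSpace ℝ E]

/-- The slope of the Dai–Yuan direction is `β` times the previous slope. -/
theorem inner_daiYuan_direction {g g' d : E} (h : ⟪d, g' - g⟫ ≠ 0) :
    ⟪g', -g' + (‖g'‖ ^ 2 / ⟪d, g' - g⟫) • d⟫ = ‖g'‖ ^ 2 / ⟪d, g' - g⟫ * ⟪g, d⟫ := by
  have hy : ⟪d, g' - g⟫ = ⟪g', d⟫ - ⟪g, d⟫ := by
    rw [inner_sub_right, real_inner_comm, real_inner_comm d g]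
  rw [inner_add_right, inner_neg_right, real_inner_smul_right, real_inner_self_eq_norm_sq]
  field_simp
  rw [hy]
  ring

/-- Growth of the squared norm relative to the squared slope for a direction `-g' + b • d`
whose slope is `b` times the previous one. -/
theorem norm_sq_div_slope_sq_le {g g' d : E} {b : ℝ} (hg' : g' ≠ 0) (hs : ⟪g, d⟫ ≠ 0)
    (hs' : ⟪g', -g' + b • d⟫ ≠ 0) (hb : ⟪g', -g' + b • d⟫ = b * ⟪g, d⟫) :
    ‖-g' + b • d‖ ^ 2 / ⟪g', -g' + b • d⟫ ^ 2 ≤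
      ‖d‖ ^ 2 / ⟪g, d⟫ ^ 2 + (‖g'‖ ^ 2)⁻¹ := by
  set d' := -g' + b • d with hd'
  have hbd : b • d = d' + g' := by rw [hd']; abel
  have hnorm : b ^ 2 * ‖d‖ ^ 2 = ‖d'‖ ^ 2 + 2 * ⟪g', d'⟫ + ‖g'‖ ^ 2 := by
    rw [real_inner_comm, ← norm_add_sq_real, ← hbd, norm_smul, mul_pow, Real.norm_eq_abs, sq_abs]
  have hb0 : b ≠ 0 := by
    rintro rfl
    exact hs' (by rw [hb, zero_mul])
  have hratio : ‖d‖ ^ 2 / ⟪g, d⟫ ^ 2 = b ^ 2 * ‖d‖ ^ 2 / ⟪g', d'⟫ ^ 2 := by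
    rw [hb]
    field_simp
  have hn : ‖g'‖ ≠ 0 := norm_ne_zero_iff.2 hg'
  have hgap : (‖d'‖ ^ 2 + 2 * ⟪g', d'⟫ + ‖g'‖ ^ 2) / ⟪g', d'⟫ ^ 2 + (‖g'‖ ^ 2)⁻¹
      - ‖d'‖ ^ 2 / ⟪g', d'⟫ ^ 2 = (‖g'‖ / ⟪g', d'⟫ + ‖g'‖⁻¹) ^ 2 := by
    field_simp
    ring
  rw [hratio, hnorm]
  linarith [sq_nonneg (‖g'‖ / ⟪g', d'⟫ + ‖g'‖⁻¹)]

/-- A bound on directional increments along unit vectors scales quadratically in the direction. -/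
theorem inner_sub_le_of_unit_bound {G : E → E} {L : ℝ}
    (hLip : ∀ (x : E) (η : E) (t : ℝ), ‖η‖ = 1 → 0 ≤ t →
      |⟪G (x + t • η) - G x, η⟫| ≤ L * t)
    (x : E) {d : E} (hd : d ≠ 0) {a : ℝ} (ha : 0 ≤ a) :
    ⟪G (x + a • d) - G x, d⟫ ≤ L * a * ‖d‖ ^ 2 := by
  have hn : 0 < ‖d‖ := norm_pos_iff.2 hd
  have h := hLip x (‖d‖⁻¹ • d) (a * ‖d‖) (by simp [norm_smul, hn.ne']) (by positivity)
  rw [smul_smul, mul_assoc, mul_inv_cancel₀ hn.ne', mul_one, real_inner_smul_right] at h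
  have h2 := mul_le_mul_of_nonneg_left ((le_abs_self _).trans h) hn.le
  rw [← mul_assoc, mul_inv_cancel₀ hn.ne', one_mul] at h2
  linarith

end DaiYuan

/-- Global convergence of the Dai–Yuan conjugate gradient method in the
Euclidean (Hilbert space) case under the weak Wolfe conditions. -/
theorem dai_yuan_global_convergence_euclidean
    {E : Type*} [NormedAddCommGroup E] [InnerProductSpace ℝ E] [CompleteSpace E]
    (f : E → ℝ) (hf : Differentiable ℝ f)
    (hbdd : BddBelow (Set.range f))
    (L : ℝ) (hL : 0 < L)
    (hLip : ∀ (x : E) (η : E) (t : ℝ), ‖η‖ = 1 → 0 ≤ t →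
      |⟪gradient f (x + t • η) - gradient f x, η⟫| ≤ L * t)
    (c₁ c₂ : ℝ) (hc₁ : 0 < c₁) (hc₁c₂ : c₁ < c₂) (hc₂ : c₂ < 1)
    (x₀ : E) (x η : ℕ → E) (α : ℕ → ℝ) (β : ℕ → ℝ)
    (hx0 : x 0 = x₀)
    (hη0 : η 0 = -gradient f (x 0))
    (hα : ∀ k, 0 < α k)
    (hupdate : ∀ k, x (k + 1) = x k + α k • η k)
    (hwolfe1 : ∀ k, f (x k + α k • η k) ≤ f (x k) + c₁ * α k * ⟪gradient f (x k), η k⟫)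
    (hwolfe2 : ∀ k, ⟪gradient f (x (k + 1)), η k⟫ ≥ c₂ * ⟪gradient f (x k), η k⟫)
    (hβ : ∀ k, β (k + 1) =
      ‖gradient f (x (k + 1))‖ ^ 2 / ⟪η k, gradient f (x (k + 1)) - gradient f (x k)⟫)
    (hη : ∀ k, η (k + 1) = -gradient f (x (k + 1)) + β (k + 1) • η k)
    (hgrad : ∀ k, gradient f (x k) ≠ 0) :
    Filter.liminf (fun k => ‖gradient f (x k)‖) Filter.atTop = 0 := by
  have hslope_sub : ∀ k, ⟪η k, gradient f (x (k + 1)) - gradient f (x k)⟫ =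
      ⟪gradient f (x (k + 1)), η k⟫ - ⟪gradient f (x k), η k⟫ := fun k => by
    rw [real_inner_comm, inner_sub_left]
  have hcurv : ∀ k, ⟪gradient f (x k), η k⟫ < 0 →
      0 < ⟪η k, gradient f (x (k + 1)) - gradient f (x k)⟫ := fun k hk => by
    rw [hslope_sub]
    nlinarith [hwolfe2 k]
  have hslope : ∀ k, ⟪η k, gradient f (x (k + 1)) - gradient f (x k)⟫ ≠ 0 →
      ⟪gradient f (x (k + 1)), η (k + 1)⟫ = β (k + 1) * ⟪gradient f (x k), η k⟫ := fun k hk => by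
    rw [hη, hβ]
    exact inner_daiYuan_direction hk
  have hdesc : ∀ k, ⟪gradient f (x k), η k⟫ < 0 := by
    intro k
    induction k with
    | zero =>
      rw [hη0, inner_neg_right, real_inner_self_eq_norm_sq]
      have := norm_pos_iff.2 (hgrad 0)
      exact neg_lt_zero.2 (by positivity)
    | succ k ih =>
      have hy := hcurv k ih
      have hn := norm_pos_iff.2 (hgrad (k + 1))
      rw [hslope k hy.ne', hβ]
      exact mul_neg_of_pos_of_neg (by positivity) ih
  have hd : ∀ k, η k ≠ 0 := fun k h0 => by
    have := hdesc k
    simp [h0] at this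
  set r : ℕ → ℝ := fun k => ‖η k‖ ^ 2 / ⟪gradient f (x k), η k⟫ ^ 2 with hr_def
  have hr : ∀ k, 0 < r k := fun k =>
    div_pos (pow_pos (norm_pos_iff.2 (hd k)) 2) (sq_pos_of_neg (hdesc k))
  have hstep : ∀ k, r (k + 1) ≤ r k + (‖gradient f (x (k + 1))‖ ^ 2)⁻¹ := fun k => by
    have hb := hslope k (hcurv k (hdesc k)).ne'
    have hne := (hdesc (k + 1)).ne
    simp only [hr_def]
    rw [hη] at hb hne ⊢
    exact norm_sq_div_slope_sq_le (hgrad (k + 1)) (hdesc k).ne hne hb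
  obtain ⟨m, hm⟩ := hbdd
  have hc : 0 < c₁ * (1 - c₂) / L := div_pos (mul_pos hc₁ (sub_pos.2 hc₂)) hL
  have hzout : Summable fun k => c₁ * (1 - c₂) / L * (r k)⁻¹ := by
    refine summable_of_le_sub_succ (F := fun k => f (x k)) (m := m)
      (fun k => (mul_pos hc (inv_pos.2 (hr k))).le) (fun k => hm ⟨x k, rfl⟩) fun k => ?_
    have h1 := hwolfe1 k
    have h2 := hwolfe2 k
    have h3 := inner_sub_le_of_unit_bound hLip (x k) (hd k) (hα k).le
    have hs := hdesc k
    have hn : 0 < ‖η k‖ ^ 2 := pow_pos (norm_pos_iff.2 (hd k)) 2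
    rw [← hupdate k] at h1 h3
    rw [inner_sub_left] at h3
    simp only [hr_def]
    generalize ⟪gradient f (x k), η k⟫ = s at *
    have hα_lower : (1 - c₂) * -s / (L * ‖η k‖ ^ 2) ≤ α k := by
      rw [div_le_iff₀ (mul_pos hL hn)]
      linarith
    have hdecr := mul_le_mul_of_nonneg_left hα_lower (mul_pos hc₁ (neg_pos.2 hs)).le
    have heq : c₁ * (1 - c₂) / L * (‖η k‖ ^ 2 / s ^ 2)⁻¹ =
        c₁ * -s * ((1 - c₂) * -s / (L * ‖η k‖ ^ 2)) := by
      field_simp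
    rw [heq]
    linarith
  refine liminf_eq_zero_of_no_eventual_pos_lower_bound (fun k => norm_nonneg _) fun a ha hev => ?_
  obtain ⟨N, hN⟩ := Filter.eventually_atTop.1 hev
  refine not_summable_inv_of_le_add (C := (a ^ 2)⁻¹) (N := N) hr (fun k hk => ?_)
    ((summable_mul_left_iff hc.ne').1 hzout)
  have hle : a ≤ ‖gradient f (x (k + 1))‖ := hN (k + 1) (by omega)
  have hinv : (‖gradient f (x (k + 1))‖ ^ 2)⁻¹ ≤ (a ^ 2)⁻¹ := by gcongr
  linarith [hstep k]
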